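/- Let r ≥ 1, x > 0, and k ≥ 2 an integer. Define on 𝒲 = {(λ₁,λ₂) : λ₁ > λ₂ > 0} the function φ(λ₁,λ₂) = |λ₁f_r'(xλ₁)f_r(xλ₂) − λ₂f_r'(xλ₂)f_r(xλ₁)|^{2k}/(λ₁²−λ₂²)^{2k−2} · (λ₁λ₂)^{1+2r}, where f_r(s) = J_r(s)/s^r. Then ∫_𝒲 φ dλ < ∞. -/

import Mathlib

open MeasureTheory

/-- Bessel function of the first kind of natural order `r`, via its power series. -/
noncomputable def besselJ (r : ℕ) (s : ℝ) : ℝ :=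
  ∑' l : ℕ, ((-1 : ℝ)) ^ l * (s / 2) ^ (2 * l + r) / ((l.factorial : ℝ) * ((r + l).factorial : ℝ))

/-- The entire function `∑ (-t)^l / (l! (r+l)!)`. -/
noncomputable def besselSeries (r : ℕ) (t : ℝ) : ℝ :=
  ∑' l : ℕ, (-1 : ℝ) ^ l * t ^ l / ((l.factorial : ℝ) * ((r + l).factorial : ℝ))

lemma abs_besselSeries_term_le (r l : ℕ) (t : ℝ) :
    ‖(-1 : ℝ) ^ l * t ^ l / ((l.factorial : ℝ) * ((r + l).factorial : ℝ))‖
      ≤ |t| ^ l / (l.factorial : ℝ) := by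
  have h1 : (1 : ℝ) ≤ ((r + l).factorial : ℝ) := by
    exact_mod_cast Nat.one_le_iff_ne_zero.mpr (Nat.factorial_ne_zero _)
  have h2 : (0 : ℝ) < (l.factorial : ℝ) := by positivity
  rw [Real.norm_eq_abs, abs_div, abs_mul, abs_pow, abs_pow, abs_neg, abs_one, one_pow, one_mul,
    abs_of_pos (show (0 : ℝ) < (l.factorial : ℝ) * ((r + l).factorial : ℝ) by positivity)]
  apply div_le_div_of_nonneg_left (by positivity) h2
  nlinarith

lemma summable_besselSeries (r : ℕ) (t : ℝ) :
    Summable fun l : ℕ => (-1 : ℝ) ^ l * t ^ l / ((l.factorial : ℝ) * ((r + l).factorial : ℝ)) :=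
  Summable.of_norm_bounded (Real.summable_pow_div_factorial |t|)
    (fun l => abs_besselSeries_term_le r l t)

lemma hasDerivAt_besselSeries (r : ℕ) (t : ℝ) :
    HasDerivAt (besselSeries r) (-besselSeries (r + 1) t) t := by
  have hterm : ∀ (l : ℕ) (y : ℝ),
      (-1 : ℝ) ^ (l + 1) * (((l + 1 : ℕ) : ℝ) * y ^ l) /
        (((l + 1).factorial : ℝ) * ((r + (l + 1)).factorial : ℝ)) =
      -((-1 : ℝ) ^ l * y ^ l / ((l.factorial : ℝ) * ((r + 1 + l).factorial : ℝ))) := by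
    intro l y
    rw [show r + (l + 1) = r + 1 + l by ring, Nat.factorial_succ l]
    have h1 : (l.factorial : ℝ) ≠ 0 := by positivity
    have h2 : ((r + 1 + l).factorial : ℝ) ≠ 0 := by positivity
    have h3 : ((l + 1 : ℕ) : ℝ) ≠ 0 := by positivity
    push_cast at h3 ⊢
    field_simp
    ring
  have hsum : Summable fun l : ℕ => (-1 : ℝ) ^ l * ((l : ℝ) * t ^ (l - 1)) /
      ((l.factorial : ℝ) * ((r + l).factorial : ℝ)) := by
    rw [← summable_nat_add_iff 1]
    simp only [Nat.add_sub_cancel, hterm]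
    exact (summable_besselSeries (r + 1) t).neg
  have hval : ∑' l : ℕ, (-1 : ℝ) ^ l * ((l : ℝ) * t ^ (l - 1)) /
      ((l.factorial : ℝ) * ((r + l).factorial : ℝ)) = -besselSeries (r + 1) t := by
    rw [hsum.tsum_eq_zero_add]
    simp only [Nat.add_sub_cancel, hterm, tsum_neg]
    simp [besselSeries]
  rw [← hval]
  let u : ℕ → ℝ := fun l => match l with
    | 0 => 0
    | m + 1 => (|t| + 1) ^ m / (m.factorial : ℝ)
  have hu : Summable u := by
    rw [← summable_nat_add_iff 1]
    exact Real.summable_pow_div_factorial (|t| + 1)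
  refine hasDerivAt_tsum_of_isPreconnected (t := Metric.ball (0 : ℝ) (|t| + 1)) (y₀ := t)
    (g' := fun (l : ℕ) (y : ℝ) => (-1 : ℝ) ^ l * ((l : ℝ) * y ^ (l - 1)) /
      ((l.factorial : ℝ) * ((r + l).factorial : ℝ)))
    hu Metric.isOpen_ball (convex_ball _ _).isPreconnected ?_ ?_ (Metric.mem_ball.mpr (by simp))
    (summable_besselSeries r t) (Metric.mem_ball.mpr (by simp))
  · intro l y _
    exact ((hasDerivAt_pow l y).const_mul _).div_const _
  · intro l y hy
    have hy' : |y| ≤ |t| + 1 := by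
      have := hy
      simp only [Metric.mem_ball, dist_zero_right, Real.norm_eq_abs] at this
      exact this.le
    cases l with
    | zero => simp [u]
    | succ m =>
      simp only [Nat.add_sub_cancel, hterm, norm_neg]
      refine (abs_besselSeries_term_le (r + 1) m y).trans ?_
      simp only [u]
      gcongr

lemma besselSeries_recurrence (r : ℕ) (t : ℝ) :
    besselSeries r t = (r + 1) * besselSeries (r + 1) t - t * besselSeries (r + 2) t := by
  have h0 := summable_besselSeries (r + 1) t
  have h2 := summable_besselSeries (r + 2) t
  have e : besselSeries r t - (r + 1) * besselSeries (r + 1) t = -(t * besselSeries (r + 2) t) := by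
    unfold besselSeries
    rw [← tsum_mul_left, ← tsum_mul_left, ← tsum_neg,
      ← (summable_besselSeries r t).tsum_sub (h0.mul_left _),
      ((summable_besselSeries r t).sub (h0.mul_left _)).tsum_eq_zero_add]
    have hz : (-1 : ℝ) ^ 0 * t ^ 0 / ((Nat.factorial 0 : ℝ) * ((r + 0).factorial : ℝ)) -
        (r + 1) * ((-1 : ℝ) ^ 0 * t ^ 0 / ((Nat.factorial 0 : ℝ) * ((r + 1 + 0).factorial : ℝ)))
        = 0 := by
      have h1 : (r.factorial : ℝ) ≠ 0 := by positivity
      have h3 : (r : ℝ) + 1 ≠ 0 := by positivity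
      simp only [Nat.add_zero, Nat.factorial_succ r]
      push_cast
      field_simp
      simp
    rw [hz, zero_add]
    congr 1
    ext l
    rw [show r + (l + 1) = r + 1 + l by ring, show r + 1 + (l + 1) = (r + 1 + l) + 1 by ring,
      show r + 2 + l = (r + 1 + l) + 1 by ring, Nat.factorial_succ (r + 1 + l),
      Nat.factorial_succ l]
    have h1 : (l.factorial : ℝ) ≠ 0 := by positivity
    have h3 : ((r + 1 + l).factorial : ℝ) ≠ 0 := by positivity
    have h4 : (l : ℝ) + 1 ≠ 0 := by positivity
    have h5 : (r : ℝ) + 1 + l + 1 ≠ 0 := by positivity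
    push_cast
    field_simp
    ring
  linarith

/-- The entire extension of `J_r(s) / s^r`. -/
noncomputable def normalizedBessel (r : ℕ) (s : ℝ) : ℝ := besselSeries r (s ^ 2 / 4) / 2 ^ r

lemma besselJ_div_pow (r : ℕ) {s : ℝ} (hs : s ≠ 0) :
    besselJ r s / s ^ r = normalizedBessel r s := by
  unfold besselJ normalizedBessel besselSeries
  rw [← tsum_div_const, ← tsum_div_const]
  congr 1
  ext l
  rw [pow_add, pow_mul, show (s / 2) ^ 2 = s ^ 2 / 4 by ring, div_pow s 2 r]
  field_simp

lemma hasDerivAt_normalizedBessel (r : ℕ) (s : ℝ) :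
    HasDerivAt (normalizedBessel r) (-(s * normalizedBessel (r + 1) s)) s := by
  have h := ((hasDerivAt_besselSeries r (s ^ 2 / 4)).comp s
    ((hasDerivAt_pow 2 s).div_const 4)).div_const (2 ^ r)
  refine h.congr_deriv ?_
  simp only [normalizedBessel, pow_succ]
  field_simp
  push_cast
  ring

lemma hasDerivAt_normalizedBessel_succ (r : ℕ) {s : ℝ} (hs : s ≠ 0) :
    HasDerivAt (normalizedBessel (r + 1))
      ((normalizedBessel r s - (2 * r + 2) * normalizedBessel (r + 1) s) / s) s := by
  refine (hasDerivAt_normalizedBessel (r + 1) s).congr_deriv ?_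
  simp only [normalizedBessel, besselSeries_recurrence r, pow_succ]
  field_simp
  ring

lemma continuous_normalizedBessel (r : ℕ) : Continuous (normalizedBessel r) :=
  continuous_iff_continuousAt.mpr fun s => (hasDerivAt_normalizedBessel r s).continuousAt

lemma deriv_besselJ_div_pow (r : ℕ) {s : ℝ} (hs : s ≠ 0) :
    deriv (fun u : ℝ => besselJ r u / u ^ r) s = -(s * normalizedBessel (r + 1) s) := by
  rw [← (hasDerivAt_normalizedBessel r s).deriv]
  apply Filter.EventuallyEq.deriv_eq
  filter_upwards [isOpen_ne.mem_nhds hs] with u hu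
  exact besselJ_div_pow r hu

/-- A modified energy of the Bessel equation, comparable with `s (J_r² + J_{r+1}²)`. -/
noncomputable def besselEnergy (r : ℕ) (s : ℝ) : ℝ :=
  s ^ (2 * r + 1) * (normalizedBessel r s ^ 2 + s ^ 2 * normalizedBessel (r + 1) s ^ 2
    - (2 * r + 1) * normalizedBessel r s * normalizedBessel (r + 1) s)

lemma hasDerivAt_besselEnergy (r : ℕ) {s : ℝ} (hs : s ≠ 0) :
    HasDerivAt (besselEnergy r)
      ((2 * r + 1) * s ^ (2 * r) * normalizedBessel r s * normalizedBessel (r + 1) s) s := by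
  have hf := hasDerivAt_normalizedBessel r s
  have hF := hasDerivAt_normalizedBessel_succ r hs
  have h := (hasDerivAt_pow (2 * r + 1) s).mul
    (((hf.pow 2).add ((hasDerivAt_pow 2 s).mul (hF.pow 2))).sub
      ((hf.const_mul (2 * (r : ℝ) + 1)).mul hF))
  refine h.congr_deriv ?_
  simp only [Nat.add_sub_cancel, Pi.mul_apply, Pi.add_apply, Pi.sub_apply, Pi.pow_apply]
  push_cast
  field_simp
  ring

lemma le_two_mul_besselEnergy (r : ℕ) {s : ℝ} (hs : 2 * (2 * (r : ℝ) + 1) ≤ s) :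
    s ^ (2 * r + 1) * (normalizedBessel r s ^ 2 + s ^ 2 * normalizedBessel (r + 1) s ^ 2)
      ≤ 2 * besselEnergy r s := by
  have hr : (0 : ℝ) ≤ r := Nat.cast_nonneg r
  have hs0 : 0 < s := by linarith
  unfold besselEnergy
  set f := normalizedBessel r s
  set F := normalizedBessel (r + 1) s
  have key : 2 * (2 * (r : ℝ) + 1) * (f * F) ≤ f ^ 2 + s ^ 2 * F ^ 2 := by
    have h1 : 2 * (2 * (r : ℝ) + 1) * (f * F) ≤ s * |f * F| := by
      have : f * F ≤ |f * F| := le_abs_self _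
      have h0 : 0 ≤ |f * F| := abs_nonneg _
      nlinarith
    have h2 : s * |f * F| ≤ f ^ 2 + s ^ 2 * F ^ 2 := by
      rw [abs_mul, ← sq_abs f, ← sq_abs F]
      nlinarith [sq_nonneg (|f| - s * |F|), sq_nonneg (|f|), sq_nonneg (s * |F|)]
    exact h1.trans h2
  have hp : 0 < s ^ (2 * r + 1) := by positivity
  nlinarith [mul_le_mul_of_nonneg_left key hp.le]

lemma besselEnergy_bounded (r : ℕ) {s : ℝ} (hs : 2 * (2 * (r : ℝ) + 1) ≤ s) :
    besselEnergy r s ≤ 2 * besselEnergy r (2 * (2 * (r : ℝ) + 1)) := by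
  have hr : (0 : ℝ) ≤ r := Nat.cast_nonneg r
  set n : ℝ := 2 * (r : ℝ) + 1 with hn
  have hn0 : 0 < n := by linarith
  have hderiv : ∀ y : ℝ, 0 < y → HasDerivAt (fun y => besselEnergy r y * (1 + 2 * n / y))
      (n * y ^ (2 * r) * normalizedBessel r y * normalizedBessel (r + 1) y * (1 + 2 * n / y)
        + besselEnergy r y * (-(2 * n) / y ^ 2)) y := by
    intro y hy
    have h1 := hasDerivAt_besselEnergy r hy.ne'
    have h2 : HasDerivAt (fun y : ℝ => 1 + 2 * n / y) (-(2 * n) / y ^ 2) y := by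
      have := ((hasDerivAt_inv hy.ne').const_mul (2 * n)).const_add 1
      refine (this.congr_deriv ?_)
      field_simp
    exact h1.mul h2
  have hanti : AntitoneOn (fun y => besselEnergy r y * (1 + 2 * n / y)) (Set.Ici (2 * n)) := by
    apply antitoneOn_of_deriv_nonpos (convex_Ici _)
    · intro y hy
      exact (hderiv y (by have := Set.mem_Ici.mp hy; linarith)).continuousAt.continuousWithinAt
    · intro y hy
      rw [interior_Ici] at hy
      exact (hderiv y (by have := Set.mem_Ioi.mp hy; linarith)).differentiableAt.differentiableWithinAt
    · intro y hy
      rw [interior_Ici] at hy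
      have hy2 : 2 * n < y := hy
      have hy0 : 0 < y := by linarith
      rw [(hderiv y hy0).deriv]
      have hE := le_two_mul_besselEnergy r hy2.le
      set f := normalizedBessel r y
      set F := normalizedBessel (r + 1) y
      set E := besselEnergy r y
      have hp : 0 < y ^ (2 * r) := by positivity
      have hEn : 0 ≤ E := by
        have : 0 ≤ y ^ (2 * r + 1) * (f ^ 2 + y ^ 2 * F ^ 2) := by positivity
        linarith
      have h3 : y ^ 2 * (y ^ (2 * r) * f * F) ≤ E := by
        have : y ^ 2 * (y ^ (2 * r) * f * F) = y ^ (2 * r + 1) * (y * f * F) := by ring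
        rw [this]
        have h4 : y * f * F ≤ (f ^ 2 + y ^ 2 * F ^ 2) / 2 := by nlinarith [sq_nonneg (f - y * F)]
        have := mul_le_mul_of_nonneg_left h4 (show 0 ≤ y ^ (2 * r + 1) by positivity)
        linarith
      have h5 : y ^ (2 * r) * f * F ≤ E / y ^ 2 := by
        rw [le_div_iff₀ (by positivity)]; linarith
      have h6 : 2 * n / y ≤ 1 := by rw [div_le_one hy0]; exact hy2.le
      have h7 : 0 < 2 * n / y := by positivity
      have h8 : 0 ≤ E / y ^ 2 := by positivity
      have h9 : n * y ^ (2 * r) * f * F * (1 + 2 * n / y) ≤ n * (E / y ^ 2) * 2 := by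
        calc n * y ^ (2 * r) * f * F * (1 + 2 * n / y)
            = n * (1 + 2 * n / y) * (y ^ (2 * r) * f * F) := by ring
          _ ≤ n * (1 + 2 * n / y) * (E / y ^ 2) := by gcongr
          _ ≤ n * 2 * (E / y ^ 2) := by gcongr; linarith
          _ = _ := by ring
      have h10 : E * (-(2 * n) / y ^ 2) = - (n * (E / y ^ 2) * 2) := by ring
      linarith
  have h := hanti (Set.mem_Ici.mpr le_rfl) (Set.mem_Ici.mpr hs) hs
  simp only at h
  rw [div_self (by positivity)] at h
  have hs0 : 0 < s := by linarith
  have hEn : 0 ≤ besselEnergy r s := by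
    have := le_two_mul_besselEnergy r hs
    have : 0 ≤ s ^ (2 * r + 1) *
      (normalizedBessel r s ^ 2 + s ^ 2 * normalizedBessel (r + 1) s ^ 2) := by positivity
    linarith
  have : 0 ≤ besselEnergy r s * (2 * n / s) := by positivity
  linarith

lemma exists_normalizedBessel_decay (r : ℕ) :
    ∃ C : ℝ, 0 < C ∧ ∀ s : ℝ, 0 ≤ s → normalizedBessel r s ^ 2 * (1 + s) ^ (2 * r + 1) ≤ C ∧
      normalizedBessel (r + 1) s ^ 2 * (1 + s) ^ (2 * r + 3) ≤ C := by
  have hr : (0 : ℝ) ≤ r := Nat.cast_nonneg r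
  set S : ℝ := 2 * (2 * (r : ℝ) + 1) with hS
  let W : ℝ → ℝ := fun s => (1 + s) ^ (2 * r + 1) *
    (normalizedBessel r s ^ 2 + (1 + s) ^ 2 * normalizedBessel (r + 1) s ^ 2)
  have hW : Continuous W := by
    have := continuous_normalizedBessel r
    have := continuous_normalizedBessel (r + 1)
    fun_prop
  obtain ⟨M, hM⟩ := (isCompact_Icc (a := (0 : ℝ)) (b := S)).bddAbove_image hW.continuousOn
  have hM' : ∀ s ∈ Set.Icc (0 : ℝ) S, W s ≤ M := fun s hs => hM (Set.mem_image_of_mem _ hs)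
  have hfar : ∀ s, S ≤ s → W s ≤ 2 ^ (2 * r + 1) * (4 * (4 * besselEnergy r S)) := by
    intro s hs
    have h1 := le_two_mul_besselEnergy r hs
    have h2 := besselEnergy_bounded r hs
    have hs1 : 1 + s ≤ 2 * s := by linarith
    have hs0 : 0 < s := by linarith
    calc W s ≤ (2 * s) ^ (2 * r + 1) *
        (4 * (normalizedBessel r s ^ 2 + s ^ 2 * normalizedBessel (r + 1) s ^ 2)) := by
          have h3 : (1 + s) ^ 2 ≤ (2 * s) ^ 2 := by gcongr
          have h4 := mul_le_mul_of_nonneg_right h3 (sq_nonneg (normalizedBessel (r + 1) s))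
          simp only [W]
          gcongr
          nlinarith [sq_nonneg (normalizedBessel r s)]
      _ = 2 ^ (2 * r + 1) * (4 * (s ^ (2 * r + 1) *
        (normalizedBessel r s ^ 2 + s ^ 2 * normalizedBessel (r + 1) s ^ 2))) := by
          rw [mul_pow]; ring
      _ ≤ _ := by
          refine mul_le_mul_of_nonneg_left ?_ (by positivity)
          linarith
  refine ⟨max 1 (max M (2 ^ (2 * r + 1) * (4 * (4 * besselEnergy r S)))),
    lt_of_lt_of_le one_pos (le_max_left _ _), fun s hs => ?_⟩
  have hWs : W s ≤ max 1 (max M (2 ^ (2 * r + 1) * (4 * (4 * besselEnergy r S)))) := by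
    rcases le_total s S with h | h
    · exact (hM' s ⟨hs, h⟩).trans ((le_max_left _ _).trans (le_max_right _ _))
    · exact (hfar s h).trans ((le_max_right _ _).trans (le_max_right _ _))
  have h1 : 0 ≤ normalizedBessel r s ^ 2 * (1 + s) ^ (2 * r + 1) := by positivity
  have h2 : 0 ≤ normalizedBessel (r + 1) s ^ 2 * (1 + s) ^ (2 * r + 3) := by positivity
  have h3 : W s = normalizedBessel r s ^ 2 * (1 + s) ^ (2 * r + 1) +
      normalizedBessel (r + 1) s ^ 2 * (1 + s) ^ (2 * r + 3) := by simp only [W]; ring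
  constructor <;> linarith

/-- The alternating numerator `b² f_{r+1}(b) f_r(a) - a² f_{r+1}(a) f_r(b)`. -/
noncomputable def besselAlternant (r : ℕ) (a b : ℝ) : ℝ :=
  b ^ 2 * normalizedBessel (r + 1) b * normalizedBessel r a -
    a ^ 2 * normalizedBessel (r + 1) a * normalizedBessel r b

lemma exists_sub_eq_of_hasDerivAt_mul {g g' : ℝ → ℝ} {a b : ℝ} (hb : 0 < b) (hab : b < a)
    (hg : ∀ s, 0 < s → HasDerivAt g (s * g' s) s) :
    ∃ c, b < c ∧ g a - g b = (a ^ 2 - b ^ 2) * (g' c / 2) := by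
  obtain ⟨c, hc, h⟩ := exists_ratio_hasDerivAt_eq_ratio_slope g (fun s => s * g' s) hab
    (fun s hs => (hg s (hb.trans_le hs.1)).continuousAt.continuousWithinAt)
    (fun s hs => hg s (hb.trans hs.1)) (fun s => s ^ 2) (fun s => 2 * s)
    (by fun_prop) (fun s _ => by simpa using hasDerivAt_pow 2 s)
  refine ⟨c, hc.1, ?_⟩
  have hc0 : c ≠ 0 := (hb.trans hc.1).ne'
  apply mul_right_cancel₀ (mul_ne_zero two_ne_zero hc0)
  linear_combination -h

lemma exists_besselAlternant_bounds (r : ℕ) :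
    ∃ C : ℝ, 0 < C ∧ ∀ a b : ℝ, 0 < b → b < a →
      besselAlternant r a b ^ 2 * ((1 + a) * (1 + b)) ^ (2 * r + 1) ≤ C * (1 + a) ^ 2 ∧
      ∃ Q, besselAlternant r a b = (a ^ 2 - b ^ 2) * Q ∧
        Q ^ 2 * (1 + b) ^ (2 * (2 * r + 1)) ≤ C := by
  obtain ⟨C, hC, hdec⟩ := exists_normalizedBessel_decay r
  refine ⟨(4 + 4 * r ^ 2) * C ^ 2, by positivity, fun a b hb hab => ⟨?_, ?_⟩⟩
  · have ha : 0 < a := hb.trans hab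
    obtain ⟨ha1, ha2⟩ := hdec a ha.le
    obtain ⟨hb1, hb2⟩ := hdec b hb.le
    unfold besselAlternant
    set f := normalizedBessel r a
    set F := normalizedBessel (r + 1) a
    set f' := normalizedBessel r b
    set F' := normalizedBessel (r + 1) b
    have hX : (b ^ 2 * F' * f) ^ 2 * ((1 + a) * (1 + b)) ^ (2 * r + 1) ≤ C ^ 2 * (1 + a) ^ 2 := by
      calc (b ^ 2 * F' * f) ^ 2 * ((1 + a) * (1 + b)) ^ (2 * r + 1)
          = b ^ 4 * F' ^ 2 * (1 + b) ^ (2 * r + 1) * (f ^ 2 * (1 + a) ^ (2 * r + 1)) := by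
            rw [mul_pow (1 + a) (1 + b)]; ring
        _ ≤ (1 + b) ^ 4 * F' ^ 2 * (1 + b) ^ (2 * r + 1) * (f ^ 2 * (1 + a) ^ (2 * r + 1)) := by
            gcongr; linarith
        _ = (F' ^ 2 * (1 + b) ^ (2 * r + 3)) * (f ^ 2 * (1 + a) ^ (2 * r + 1)) * (1 + b) ^ 2 := by
            ring
        _ ≤ C * C * (1 + a) ^ 2 := by gcongr
        _ = _ := by ring
    have hY : (a ^ 2 * F * f') ^ 2 * ((1 + a) * (1 + b)) ^ (2 * r + 1) ≤ C ^ 2 * (1 + a) ^ 2 := by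
      calc (a ^ 2 * F * f') ^ 2 * ((1 + a) * (1 + b)) ^ (2 * r + 1)
          = a ^ 4 * F ^ 2 * (1 + a) ^ (2 * r + 1) * (f' ^ 2 * (1 + b) ^ (2 * r + 1)) := by
            rw [mul_pow (1 + a) (1 + b)]; ring
        _ ≤ (1 + a) ^ 4 * F ^ 2 * (1 + a) ^ (2 * r + 1) * (f' ^ 2 * (1 + b) ^ (2 * r + 1)) := by
            gcongr; linarith
        _ = (F ^ 2 * (1 + a) ^ (2 * r + 3)) * (f' ^ 2 * (1 + b) ^ (2 * r + 1)) * (1 + a) ^ 2 := by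
            ring
        _ ≤ C * C * (1 + a) ^ 2 := by gcongr
        _ = _ := by ring
    have hP : 0 ≤ ((1 + a) * (1 + b)) ^ (2 * r + 1) := by positivity
    have h1 : (b ^ 2 * F' * f - a ^ 2 * F * f') ^ 2 ≤
        2 * (b ^ 2 * F' * f) ^ 2 + 2 * (a ^ 2 * F * f') ^ 2 := by
      nlinarith [sq_nonneg (b ^ 2 * F' * f + a ^ 2 * F * f')]
    have h2 := mul_le_mul_of_nonneg_right h1 hP
    have h3 : 0 ≤ 4 * (r : ℝ) ^ 2 * C ^ 2 * (1 + a) ^ 2 := by positivity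
    nlinarith
  · obtain ⟨c, hc, hfc⟩ := exists_sub_eq_of_hasDerivAt_mul (g := normalizedBessel r)
      (g' := fun s => -normalizedBessel (r + 1) s) hb hab
      (fun s _ => (hasDerivAt_normalizedBessel r s).congr_deriv (by ring))
    obtain ⟨d, hd, hgd⟩ := exists_sub_eq_of_hasDerivAt_mul
      (g := fun s => s ^ 2 * normalizedBessel (r + 1) s)
      (g' := fun s => normalizedBessel r s - 2 * r * normalizedBessel (r + 1) s) hb hab
      (fun s hs => ((hasDerivAt_pow 2 s).mul
        (hasDerivAt_normalizedBessel_succ r hs.ne')).congr_deriv (by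
          have := hs.ne'
          field_simp
          push_cast
          ring))
    refine ⟨-(b ^ 2 * normalizedBessel (r + 1) b * normalizedBessel (r + 1) c +
      normalizedBessel r b * normalizedBessel r d -
      2 * r * (normalizedBessel r b * normalizedBessel (r + 1) d)) / 2, ?_, ?_⟩
    · unfold besselAlternant
      linear_combination b ^ 2 * normalizedBessel (r + 1) b * hfc - normalizedBessel r b * hgd
    · obtain ⟨hb1, hb2⟩ := hdec b hb.le
      have hc2 := (hdec c (hb.trans hc).le).2
      obtain ⟨hd1, hd2⟩ := hdec d (hb.trans hd).le
      have hc2' : normalizedBessel (r + 1) c ^ 2 * (1 + b) ^ (2 * r + 3) ≤ C :=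
        le_trans (by gcongr) hc2
      have hd1' : normalizedBessel r d ^ 2 * (1 + b) ^ (2 * r + 1) ≤ C :=
        le_trans (by gcongr) hd1
      have hd2' : normalizedBessel (r + 1) d ^ 2 * (1 + b) ^ (2 * r + 1) ≤ C := by
        refine le_trans ?_ hd2
        calc _ ≤ normalizedBessel (r + 1) d ^ 2 * (1 + b) ^ (2 * r + 3) := by
              gcongr <;> linarith
          _ ≤ _ := by gcongr
      set X := b ^ 2 * normalizedBessel (r + 1) b * normalizedBessel (r + 1) c with hXdef
      set Y := normalizedBessel r b * normalizedBessel r d with hYdef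
      set Z := normalizedBessel r b * normalizedBessel (r + 1) d with hZdef
      have hX : X ^ 2 * (1 + b) ^ (2 * (2 * r + 1)) ≤ C ^ 2 := by
        calc X ^ 2 * (1 + b) ^ (2 * (2 * r + 1))
            = b ^ 4 * (normalizedBessel (r + 1) b ^ 2 * normalizedBessel (r + 1) c ^ 2 *
              (1 + b) ^ (2 * (2 * r + 1))) := by rw [hXdef]; ring
          _ ≤ (1 + b) ^ 4 * (normalizedBessel (r + 1) b ^ 2 * normalizedBessel (r + 1) c ^ 2 *
              (1 + b) ^ (2 * (2 * r + 1))) := by gcongr; linarith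
          _ = (normalizedBessel (r + 1) b ^ 2 * (1 + b) ^ (2 * r + 3)) *
              (normalizedBessel (r + 1) c ^ 2 * (1 + b) ^ (2 * r + 3)) := by ring
          _ ≤ C * C := by gcongr
          _ = _ := by ring
      have hY : Y ^ 2 * (1 + b) ^ (2 * (2 * r + 1)) ≤ C ^ 2 := by
        calc Y ^ 2 * (1 + b) ^ (2 * (2 * r + 1))
            = (normalizedBessel r b ^ 2 * (1 + b) ^ (2 * r + 1)) *
              (normalizedBessel r d ^ 2 * (1 + b) ^ (2 * r + 1)) := by rw [hYdef]; ring
          _ ≤ C * C := by gcongr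
          _ = _ := by ring
      have hZ : Z ^ 2 * (1 + b) ^ (2 * (2 * r + 1)) ≤ C ^ 2 := by
        calc Z ^ 2 * (1 + b) ^ (2 * (2 * r + 1))
            = (normalizedBessel r b ^ 2 * (1 + b) ^ (2 * r + 1)) *
              (normalizedBessel (r + 1) d ^ 2 * (1 + b) ^ (2 * r + 1)) := by rw [hZdef]; ring
          _ ≤ C * C := by gcongr
          _ = _ := by ring
      have hP : 0 ≤ (1 + b) ^ (2 * (2 * r + 1)) := by positivity
      have h1 : (-(X + Y - 2 * r * Z) / 2) ^ 2 ≤ X ^ 2 + Y ^ 2 + 4 * r ^ 2 * Z ^ 2 := by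
        nlinarith [sq_nonneg (X - Y), sq_nonneg (X + 2 * r * Z), sq_nonneg (Y + 2 * r * Z),
          sq_nonneg X, sq_nonneg Y, sq_nonneg (r * Z)]
      have h2 := mul_le_mul_of_nonneg_right h1 hP
      have h3 := mul_le_mul_of_nonneg_left hZ (show 0 ≤ 4 * (r : ℝ) ^ 2 by positivity)
      have h4 : 0 ≤ C ^ 2 := sq_nonneg C
      linarith

lemma exists_besselAlternant_integrand_bound (r : ℕ) (hr : 1 ≤ r) (k : ℕ) (hk : 2 ≤ k) :
    ∃ C : ℝ, 0 < C ∧ ∀ a b : ℝ, 0 < b → b < a →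
      |besselAlternant r a b| ^ (2 * k) / (a ^ 2 - b ^ 2) ^ (2 * k - 2) * (a * b) ^ (1 + 2 * r)
        ≤ C * ((1 + b ^ 2)⁻¹ * (1 + (a - b) ^ 2)⁻¹) := by
  obtain ⟨C, hC, hbd⟩ := exists_besselAlternant_bounds r
  obtain ⟨m, rfl⟩ := Nat.exists_eq_add_of_le' hk
  have e : 2 * (m + 2) - 2 = 2 * m + 2 := by omega
  refine ⟨C ^ m * C * (8 * C), by positivity, fun a b hb hab => ?_⟩
  obtain ⟨hN, Q, hQ, hQ2⟩ := hbd a b hb hab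
  have ha : 0 < a := hb.trans hab
  have hD : 0 < a ^ 2 - b ^ 2 := by nlinarith
  have hr3 : 3 ≤ 2 * r + 1 := by omega
  have hQC : Q ^ 2 ≤ C := by
    refine le_trans ?_ hQ2
    exact le_mul_of_one_le_right (sq_nonneg Q) (one_le_pow₀ (by linarith))
  have hN' : besselAlternant r a b ^ 2 * (a * b) ^ (1 + 2 * r) ≤ C * (1 + a) ^ 2 := by
    refine le_trans ?_ hN
    rw [add_comm 1 (2 * r)]
    gcongr <;> linarith
  have hmain : (1 + a) ^ 2 * Q ^ 2 * ((1 + b ^ 2) * (1 + (a - b) ^ 2)) ≤ 8 * C := by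
    have hb2 : 1 + b ^ 2 ≤ (1 + b) ^ 2 := by nlinarith
    rcases le_total (a - b) 1 with h | h
    · calc (1 + a) ^ 2 * Q ^ 2 * ((1 + b ^ 2) * (1 + (a - b) ^ 2))
          ≤ (2 * (1 + b)) ^ 2 * Q ^ 2 * ((1 + b) ^ 2 * 2) := by
            gcongr
            · linarith
            · nlinarith
        _ = 8 * (Q ^ 2 * (1 + b) ^ 4) := by ring
        _ ≤ 8 * (Q ^ 2 * (1 + b) ^ (2 * (2 * r + 1))) := by
            gcongr
            · linarith
            · omega
        _ ≤ 8 * C := by gcongr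
    · have hlow : a ^ 2 * ((a - b) ^ 2 * Q ^ 2 * ((1 + a) ^ 2 * (1 + b) ^ 2)) ≤
          a ^ 2 * (4 * C) := by
        calc a ^ 2 * ((a - b) ^ 2 * Q ^ 2 * ((1 + a) ^ 2 * (1 + b) ^ 2))
            = a ^ 2 * ((a - b) ^ 2 * Q ^ 2) * ((1 + a) * (1 + b)) ^ 2 := by ring
          _ ≤ (a + b) ^ 2 * ((a - b) ^ 2 * Q ^ 2) * ((1 + a) * (1 + b)) ^ (2 * r + 1) := by
              gcongr
              · linarith
              · nlinarith
              · omega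
          _ = besselAlternant r a b ^ 2 * ((1 + a) * (1 + b)) ^ (2 * r + 1) := by
              rw [hQ]; ring
          _ ≤ C * (1 + a) ^ 2 := hN
          _ ≤ C * (2 * a) ^ 2 := by gcongr; linarith
          _ = _ := by ring
      have hlow' := le_of_mul_le_mul_left hlow (by positivity)
      calc (1 + a) ^ 2 * Q ^ 2 * ((1 + b ^ 2) * (1 + (a - b) ^ 2))
          ≤ (1 + a) ^ 2 * Q ^ 2 * ((1 + b) ^ 2 * (2 * (a - b) ^ 2)) := by
            gcongr
            nlinarith
        _ = 2 * ((a - b) ^ 2 * Q ^ 2 * ((1 + a) ^ 2 * (1 + b) ^ 2)) := by ring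
        _ ≤ 8 * C := by linarith
  have hsplit : |besselAlternant r a b| ^ (2 * (m + 2)) / (a ^ 2 - b ^ 2) ^ (2 * (m + 2) - 2) *
      (a * b) ^ (1 + 2 * r) =
      (Q ^ 2) ^ m * Q ^ 2 * (besselAlternant r a b ^ 2 * (a * b) ^ (1 + 2 * r)) := by
    rw [e, pow_mul, sq_abs, hQ, div_mul_eq_mul_div, div_eq_iff (by positivity)]
    generalize a ^ 2 - b ^ 2 = D
    ring
  rw [hsplit, ← mul_inv, ← div_eq_mul_inv, le_div_iff₀ (by positivity)]
  calc (Q ^ 2) ^ m * Q ^ 2 * (besselAlternant r a b ^ 2 * (a * b) ^ (1 + 2 * r)) *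
        ((1 + b ^ 2) * (1 + (a - b) ^ 2))
      ≤ C ^ m * Q ^ 2 * (C * (1 + a) ^ 2) * ((1 + b ^ 2) * (1 + (a - b) ^ 2)) := by gcongr
    _ = C ^ m * C * ((1 + a) ^ 2 * Q ^ 2 * ((1 + b ^ 2) * (1 + (a - b) ^ 2))) := by ring
    _ ≤ C ^ m * C * (8 * C) := by gcongr

lemma integrable_inv_one_add_sq_mul_inv_one_add_sub_sq {x : ℝ} (hx : x ≠ 0) :
    Integrable fun p : ℝ × ℝ =>
      (1 + (x * p.2) ^ 2)⁻¹ * (1 + (x * p.1 - x * p.2) ^ 2)⁻¹ := by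
  have h : Integrable fun t : ℝ => (1 + (x * t) ^ 2)⁻¹ :=
    integrable_inv_one_add_sq.comp_mul_left' hx
  have h2 := h.convolution_integrand (ContinuousLinearMap.mul ℝ ℝ) h
  simp only [ContinuousLinearMap.mul_apply', mul_sub] at h2
  exact h2

/-- Type D singular point, `q > 2` (`r ≥ 1`): for `x > 0` and integer `k ≥ 2`, the
Plancherel test integral over the Weyl chamber `{λ₁ > λ₂ > 0}` is finite, where
`f_r(s) = J_r(s)/s^r` and `f_r'` is its derivative. -/
theorem stmt_12 (r : ℕ) (hr : 1 ≤ r) (x : ℝ) (hx : 0 < x) (k : ℕ) (hk : 2 ≤ k) :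
    ∫⁻ p in {p : ℝ × ℝ | 0 < p.2 ∧ p.2 < p.1},
      ENNReal.ofReal
        (|p.1 * deriv (fun u : ℝ => besselJ r u / u ^ r) (x * p.1)
              * (besselJ r (x * p.2) / (x * p.2) ^ r)
            - p.2 * deriv (fun u : ℝ => besselJ r u / u ^ r) (x * p.2)
              * (besselJ r (x * p.1) / (x * p.1) ^ r)| ^ (2 * k)
          / (p.1 ^ 2 - p.2 ^ 2) ^ (2 * k - 2) * (p.1 * p.2) ^ (1 + 2 * r)) < ⊤ := by
  obtain ⟨C, hC, hbd⟩ := exists_besselAlternant_integrand_bound r hr k hk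
  set c : ℝ := (x ^ (2 * k))⁻¹ * (x ^ 2) ^ (2 * k - 2) * ((x ^ 2) ^ (1 + 2 * r))⁻¹ with hc
  have hc0 : 0 ≤ c := by positivity
  have hint := (integrable_inv_one_add_sq_mul_inv_one_add_sub_sq hx.ne').const_mul (c * C)
  have hmeas : MeasurableSet {p : ℝ × ℝ | 0 < p.2 ∧ p.2 < p.1} :=
    ((isOpen_lt continuous_const continuous_snd).inter
      (isOpen_lt continuous_snd continuous_fst)).measurableSet
  refine lt_of_le_of_lt (setLIntegral_mono' hmeas fun p hp => ENNReal.ofReal_le_ofReal ?_)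
    (lt_of_le_of_lt (setLIntegral_le_lintegral _ _) hint.lintegral_lt_top)
  obtain ⟨hp2, hp12⟩ := hp
  have hp1 : 0 < p.1 := hp2.trans hp12
  have h1 : x * p.1 ≠ 0 := by positivity
  have h2 : x * p.2 ≠ 0 := by positivity
  rw [deriv_besselJ_div_pow r h1, deriv_besselJ_div_pow r h2, besselJ_div_pow r h1,
    besselJ_div_pow r h2]
  have hle := mul_le_mul_of_nonneg_left
    (hbd (x * p.1) (x * p.2) (by positivity) (by gcongr)) hc0
  rw [← mul_assoc c C] at hle
  refine le_trans (le_of_eq ?_) hle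
  have hnum : p.1 * -(x * p.1 * normalizedBessel (r + 1) (x * p.1)) * normalizedBessel r (x * p.2) -
      p.2 * -(x * p.2 * normalizedBessel (r + 1) (x * p.2)) * normalizedBessel r (x * p.1) =
      besselAlternant r (x * p.1) (x * p.2) / x := by
    unfold besselAlternant
    field_simp
    ring
  have hD : (x * p.1) ^ 2 - (x * p.2) ^ 2 = x ^ 2 * (p.1 ^ 2 - p.2 ^ 2) := by ring
  have hab : x * p.1 * (x * p.2) = x ^ 2 * (p.1 * p.2) := by ring
  have hD0 : p.1 ^ 2 - p.2 ^ 2 ≠ 0 := by nlinarith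
  rw [hnum, hD, hab, abs_div, abs_of_pos hx, div_pow, mul_pow (x ^ 2) (p.1 ^ 2 - p.2 ^ 2),
    mul_pow (x ^ 2) (p.1 * p.2), hc]
  field_simp
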